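/- For any τ ∈ [2, ∞] there exist uncountably many elements ξ of the missing digit set MDS(𝒜) with irrationality exponent τ(ξ) = τ. -/

import Mathlib

/-!
Setting: `𝔽_q((X⁻¹))`, the field of formal Laurent series over the finite field `𝔽_q`
with `q = pⁿ` elements (`F` below is an arbitrary finite field; its cardinality `q` is
automatically a prime power), with absolute value `|f| = q^N` when
`f = ∑_{n ≥ -N} a_{-n} X^{-n}` with `a_N ≠ 0`, and `|0| = 0`.
We model it as `LaurentSeries F` in the variable `t = X⁻¹`, so the coefficient `a_{-n}` of
`X^{-n}` is the coefficient of `t^n`, and `|f| = q^{-ord_t f}`.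
-/

noncomputable section
open scoped ENNReal Classical

variable (F : Type) [Field F] [Fintype F]

/-- The field `𝔽_q((X⁻¹))`, modelled as Laurent series in `t = X⁻¹`. -/
abbrev LF (F : Type) [Field F] := LaurentSeries F

/-- `q`, the cardinality of the coefficient field. -/
def qc : ℕ := Fintype.card F

/-- The element `X`, i.e. `t⁻¹`. -/
def XL : LF F := HahnSeries.single (-1 : ℤ) 1

/-- The absolute value: `|f| = q^{-ord_t f}` for `f ≠ 0` and `|0| = 0`. -/
def absv (f : LF F) : ℝ := if f = 0 then 0 else (qc F : ℝ) ^ (-f.order)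

/-- The ball of radius `r` around `x` for the ultrametric `d(x, y) = |x - y|`. -/
def ball (x : LF F) (r : ℝ) : Set (LF F) := {y | absv F (y - x) < r}

/-- The unit ball `𝕀 = {h : |h| < 1}` around `0`. -/
def unitBall : Set (LF F) := ball F 0 1

/-- The missing digit set `MDS(𝒜)`: elements of `𝕀` all of whose coefficients `a_{-n}`
lie in `𝒜`. -/
def MDS (A : Set F) : Set (LF F) :=
  {f | (∀ m : ℤ, m ≤ 0 → f.coeff m = 0) ∧ ∀ m : ℤ, 1 ≤ m → f.coeff m ∈ A}

/-- `γ_𝒜 = log #𝒜 / log q`. -/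
def gammaA (A : Set F) : ℝ := Real.log A.ncard / Real.log (qc F)

/-- The Hausdorff `f`-measure of `A ⊆ 𝔽_q((X⁻¹))`, as defined in the paper:
`ℋ^f(A) = lim_{ρ → 0} inf ∑ᵢ f(r(Bᵢ))`, the infimum being over countable covers of `A`
by balls `Bᵢ` with radius `r(Bᵢ) ≤ ρ`.  Every ball has radius `q^k` for some `k ∈ ℤ`;
a ball is recorded as a pair (centre, k).  (The `⨆` over `ρ` is the limit `ρ → 0`, the inner
infimum being antitone in `ρ`.) -/
def hmeas (f : ℝ → ℝ) (A : Set (LF F)) : ℝ≥0∞ :=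
  ⨆ (ρ : ℝ) (_ : 0 < ρ),
    ⨅ (S : Set (LF F × ℤ)) (_ : S.Countable)
      (_ : ∀ p ∈ S, (qc F : ℝ) ^ p.2 ≤ ρ)
      (_ : A ⊆ ⋃ p ∈ S, ball F p.1 ((qc F : ℝ) ^ p.2)),
      ∑' p : S, ENNReal.ofReal (f ((qc F : ℝ) ^ (p : LF F × ℤ).2))

/-- A dimension function: a continuous, non-decreasing `f : ℝ_{≥0} → ℝ_{≥0}` with `f 0 = 0`. -/
structure IsDimFun (f : ℝ → ℝ) : Prop where
  mono : MonotoneOn f (Set.Ici 0)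
  cont : ContinuousOn f (Set.Ici 0)
  zero : f 0 = 0
  nonneg : ∀ r, 0 ≤ r → 0 ≤ f r

/-- The image of a polynomial `g ∈ 𝔽_q[X]` in `𝔽_q((X⁻¹))`. -/
def toL (g : Polynomial F) : LF F := Polynomial.aeval (XL F) g

/-- `ℱ_𝒜(N)`: polynomials over `𝔽_q` of degree `< N`, all of whose coefficients
`a_0, …, a_{N-1}` lie in `𝒜`. -/
def FsetA (A : Set F) (N : ℕ) : Set (Polynomial F) :=
  {g | g.degree < (N : ℕ) ∧ ∀ k < N, g.coeff k ∈ A}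

/-- `W_{MDS(𝒜)}(ψ)`: elements `h ∈ MDS(𝒜)` with `|h - g/X^N| < ψ(q^N)` for infinitely many
`N ∈ ℕ`, where `g ∈ ℱ_𝒜(N)`.  Here `ψ N` stands for `ψ(q^N)`. -/
def WMDS (A : Set F) (ψ : ℕ → ℝ) : Set (LF F) :=
  {h ∈ MDS F A | ∀ m : ℕ, ∃ N : ℕ, m ≤ N ∧ 1 ≤ N ∧
    ∃ g ∈ FsetA F A N, absv F (h - toL F g / XL F ^ N) < ψ N}

/-- `𝒦(ψ)`: elements `ξ ∈ 𝕀` with `|ξ - g/h| < ψ(|h|)` for infinitely many fractions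
`g/h ∈ 𝔽_q(X)`.  Here `ψ d` stands for `ψ(q^d)`, and `|h| = q^{deg h}`. -/
def Kset (ψ : ℕ → ℝ) : Set (LF F) :=
  {ξ ∈ unitBall F | {gh : Polynomial F × Polynomial F | gh.2 ≠ 0 ∧
    absv F (ξ - toL F gh.1 / toL F gh.2) < ψ gh.2.natDegree}.Infinite}

/-- The irrationality exponent
`τ(ξ) = sup {τ : |ξ - g/h| < |h|^{-τ} for infinitely many g/h ∈ 𝔽_q(X)}`, valued in `[0, ∞]`. -/
def irrExp (ξ : LF F) : ℝ≥0∞ :=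
  sSup {t : ℝ≥0∞ | ∃ τ : ℝ, t = ENNReal.ofReal τ ∧
    {gh : Polynomial F × Polynomial F | gh.2 ≠ 0 ∧
      absv F (ξ - toL F gh.1 / toL F gh.2) < absv F (toL F gh.2) ^ (-τ)}.Infinite}

open Polynomial in
/-- Every fraction with denominator `h` of degree below `d` keeps a distance from `P / X ^ d`
that is at least that of exponent `2 + α`, up to the constant `C`. -/
def FoldBound {F : Type} [Field F] (P : F[X]) (d : ℕ) (α C : ℝ) : Prop :=
  ∀ h r : F[X], h ≠ 0 → h.natDegree < d → X ^ d ∣ h * P - r →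
    (d : ℝ) ≤ h.natDegree + r.natDegree + α * min (h.natDegree : ℝ) r.natDegree + C

section Folding

open Polynomial

variable {F : Type} [Field F]

theorem FoldBound.neg {P : F[X]} {d : ℕ} {α C : ℝ} (H : FoldBound P d α C) :
    FoldBound (-P) d α C := by
  intro h r h0 hd hr
  have key := H h (-r) h0 hd (by
    rw [← dvd_neg]
    convert hr using 1
    ring)
  rwa [natDegree_neg] at key

theorem ne_zero_of_X_pow_dvd_mul_sub {P h r : F[X]} {d : ℕ} (hP : P.coeff 0 ≠ 0) (h0 : h ≠ 0)
    (hd : h.natDegree < d) (hr : X ^ d ∣ h * P - r) : r ≠ 0 := by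
  rintro rfl
  rw [sub_zero] at hr
  have hX : ¬ (X : F[X]) ∣ P := by rwa [X_dvd_iff]
  have := natDegree_le_of_dvd (prime_X.pow_dvd_of_dvd_mul_right d hX hr) h0
  rw [natDegree_X_pow] at this
  omega

theorem FoldBound.of_natDegree_lt {P : F[X]} {d D : ℕ} {α C : ℝ} (hα : 0 ≤ α)
    (H : FoldBound P d α C) (hP : P.coeff 0 ≠ 0) (hD : 2 * d ≤ D) {h r : F[X]} (h0 : h ≠ 0)
    (hd : h.natDegree < d) (hr : X ^ D ∣ h * (1 + P * X ^ (D - d)) - r) :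
    (D : ℝ) ≤ h.natDegree + r.natDegree + α * min (h.natDegree : ℝ) r.natDegree + C := by
  obtain ⟨g, hg⟩ := hr
  have hX : (X : F[X]) ^ D = X ^ d * X ^ (D - d) := by
    rw [← pow_add]
    congr 1
    omega
  have hdvd : X ^ d ∣ h * P - (h * P - X ^ d * g) := ⟨g, by ring⟩
  have hs0 := ne_zero_of_X_pow_dvd_mul_sub hP h0 hd hdvd
  have key := H h _ h0 hd hdvd
  set s := h * P - X ^ d * g with hs
  have hrs : r = h + s * X ^ (D - d) := by
    rw [hX] at hg
    rw [hs]
    linear_combination -hg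
  have hdeg : (s * X ^ (D - d)).natDegree = s.natDegree + (D - d) :=
    natDegree_mul_X_pow _ hs0
  have hr : r.natDegree = s.natDegree + (D - d) := by
    rw [hrs, natDegree_add_eq_right_of_natDegree_lt, hdeg]
    omega
  have hmin : min (h.natDegree : ℝ) r.natDegree = h.natDegree := by
    apply min_eq_left
    exact_mod_cast (by omega : h.natDegree ≤ r.natDegree)
  have hle : α * min (h.natDegree : ℝ) s.natDegree ≤ α * h.natDegree :=
    mul_le_mul_of_nonneg_left (min_le_left _ _) hα
  have hrR : (r.natDegree : ℝ) + d = s.natDegree + D := by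
    exact_mod_cast (by omega : r.natDegree + d = s.natDegree + D)
  rw [hmin]
  linarith

theorem FoldBound.fold {P : F[X]} {d D : ℕ} {α C : ℝ} (hα : 0 ≤ α) (H : FoldBound P d α C)
    (hP : P.coeff 0 ≠ 0) (hd0 : 0 < d) (hD : 2 * d ≤ D) (hDC : (D : ℝ) ≤ (2 + α) * d + C) :
    FoldBound (1 + P * X ^ (D - d)) D α C := by
  intro h r h0 hhD hr
  by_cases hh : h.natDegree < d
  · exact H.of_natDegree_lt hα hP hD h0 hh hr
  by_cases hrd : r.natDegree < d
  · have hP' : (1 + P * X ^ (D - d)).coeff 0 ≠ 0 := by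
      simp [coeff_X_pow, mul_coeff_zero, show ¬ (0 = D - d) by omega]
    have hr0 := ne_zero_of_X_pow_dvd_mul_sub hP' h0 hhD hr
    have hinv : X ^ D ∣ r * (1 + -P * X ^ (D - d)) - h := by
      have h2 : (X : F[X]) ^ D ∣ X ^ (D - d) * X ^ (D - d) := by
        rw [← pow_add]
        exact pow_dvd_pow _ (by omega)
      have := dvd_sub (hr.mul_right (-(1 - P * X ^ (D - d)))) (h2.mul_right (h * P * P))
      convert this using 1
      ring
    have := H.neg.of_natDegree_lt hα (by simpa using hP) hD hr0 hrd hinv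
    rw [min_comm]
    linarith
  · have h1 : (d : ℝ) ≤ h.natDegree := by exact_mod_cast not_lt.1 hh
    have h2 : (d : ℝ) ≤ r.natDegree := by exact_mod_cast not_lt.1 hrd
    have h3 := mul_le_mul_of_nonneg_left (le_min h1 h2) hα
    linarith

/-- The numerator of `∑_{j ≤ k} X ^ (-d j)` over the denominator `X ^ d k`. -/
def foldNum (F : Type) [Field F] (d : ℕ → ℕ) : ℕ → F[X]
  | 0 => 1
  | k + 1 => 1 + foldNum F d k * X ^ (d (k + 1) - d k)

theorem foldNum_coeff_zero {d : ℕ → ℕ} (hd : StrictMono d) (k : ℕ) :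
    (foldNum F d k).coeff 0 = 1 := by
  cases k with
  | zero => simp [foldNum]
  | succ k =>
    have := hd k.lt_add_one
    simp [foldNum, coeff_X_pow, mul_coeff_zero, show ¬ (0 = d (k + 1) - d k) by omega]

theorem foldBound_foldNum {d : ℕ → ℕ} {α C : ℝ} (hα : 0 ≤ α) (hd : StrictMono d) (hd0 : 0 < d 0)
    (hC : (d 0 : ℝ) ≤ C) (h2 : ∀ k, 2 * d k ≤ d (k + 1))
    (hdC : ∀ k, (d (k + 1) : ℝ) ≤ (2 + α) * d k + C) (k : ℕ) :
    FoldBound (foldNum F d k) (d k) α C := by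
  induction k with
  | zero =>
    intro h r _ _ _
    have : 0 ≤ α * min (h.natDegree : ℝ) r.natDegree := by positivity
    have h1 : (0 : ℝ) ≤ h.natDegree := by positivity
    have h2 : (0 : ℝ) ≤ r.natDegree := by positivity
    linarith
  | succ k ih =>
    exact ih.fold hα (by simp [foldNum_coeff_zero hd]) (hd0.trans_le (hd.monotone k.zero_le))
      (h2 k) (hdC k)

end Folding

section Embedding

open Polynomial

variable {F : Type} [Field F]

theorem algebraMap_eq_single (c : F) : algebraMap F (LF F) c = HahnSeries.single 0 c :=
  (HahnSeries.algebraMap_apply' ℤ c).trans (HahnSeries.ofPowerSeries_C c)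

theorem XL_pow (n : ℕ) : XL F ^ n = HahnSeries.single (-n : ℤ) 1 := by
  simp [XL, HahnSeries.single_pow]

theorem coeff_toL (g : F[X]) (n : ℕ) : (toL F g).coeff (-n : ℤ) = g.coeff n := by
  induction g using Polynomial.induction_on' with
  | add p q hp hq => simp_all [toL]
  | monomial m c =>
    rw [toL, aeval_monomial, XL_pow, coeff_monomial, algebraMap_eq_single,
      HahnSeries.single_mul_single, HahnSeries.coeff_single]
    simp [eq_comm]

theorem coeff_toL_eq_zero (g : F[X]) {m : ℤ} (hm : m < -g.natDegree) :
    (toL F g).coeff m = 0 := by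
  obtain ⟨n, rfl⟩ : ∃ n : ℕ, m = -n := ⟨m.natAbs, by omega⟩
  rw [coeff_toL]
  exact coeff_eq_zero_of_natDegree_lt (by omega)

theorem coeff_toL_natDegree_ne_zero {g : F[X]} (hg : g ≠ 0) :
    (toL F g).coeff (-g.natDegree : ℤ) ≠ 0 := by
  rw [coeff_toL]
  exact leadingCoeff_ne_zero.2 hg

theorem toL_ne_zero {g : F[X]} (hg : g ≠ 0) : toL F g ≠ 0 := by
  intro h
  have := coeff_toL_natDegree_ne_zero hg
  simp [h] at this

theorem toL_X_pow (n : ℕ) : toL F (X ^ n) = XL F ^ n := by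
  simp [toL]

/-- The lacunary series `∑ X ^ (-n)`, over `n` in `S`. -/
def indSeries (F : Type) [Field F] (S : Set ℕ) : LF F :=
  HahnSeries.ofPowerSeries ℤ F (PowerSeries.mk fun n => if n ∈ S then 1 else 0)

theorem coeff_indSeries_natCast (S : Set ℕ) (n : ℕ) :
    (indSeries F S).coeff n = if n ∈ S then 1 else 0 := by
  rw [indSeries, HahnSeries.ofPowerSeries_apply_coeff, PowerSeries.coeff_mk]

theorem coeff_indSeries_of_neg (S : Set ℕ) {m : ℤ} (hm : m < 0) :
    (indSeries F S).coeff m = 0 :=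
  (PowerSeries.coeff_coe _ m).trans (if_pos hm)

theorem indSeries_compl_zero : indSeries F {0}ᶜ = 1 / toL F (X - 1) := by
  have hX : (X - 1 : F[X]) ≠ 0 := X_sub_C_ne_zero 1
  rw [eq_div_iff (toL_ne_zero hX)]
  have : toL F (X - 1) = HahnSeries.single (-1 : ℤ) 1 - 1 := by simp [toL, XL]
  rw [this, mul_comm, sub_mul, one_mul]
  ext m
  rw [HahnSeries.coeff_sub, HahnSeries.coeff_single_mul, one_mul, HahnSeries.coeff_one,
    sub_neg_eq_add]
  rcases lt_or_ge m (-1) with hm | hm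
  · rw [coeff_indSeries_of_neg _ (by omega), coeff_indSeries_of_neg _ (by omega),
      if_neg (by omega), sub_zero]
  · obtain ⟨n, hn⟩ : ∃ n : ℕ, m + 1 = n := ⟨(m + 1).toNat, by omega⟩
    rw [hn, coeff_indSeries_natCast]
    rcases n with - | - | n
    · rw [coeff_indSeries_of_neg _ (m := m) (by omega), if_neg (show m ≠ 0 by omega)]
      simp
    · obtain rfl : m = (0 : ℕ) := by omega
      rw [coeff_indSeries_natCast]
      simp
    · obtain rfl : m = (n + 1 : ℕ) := by omega
      rw [coeff_indSeries_natCast, if_neg (show ((n + 1 : ℕ) : ℤ) ≠ 0 by omega)]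
      simp

/-- The series whose digits are `a + c` at the positions in `S`, and `a` elsewhere. -/
def digitSeries (a c : F) (S : Set ℕ) : LF F :=
  toL F (C a) / toL F (X - 1) + toL F (C c) * indSeries F S

theorem coeff_digitSeries (a c : F) (S : Set ℕ) (m : ℤ) :
    (digitSeries a c S).coeff m =
      a * (indSeries F {0}ᶜ).coeff m + c * (indSeries F S).coeff m := by
  rw [digitSeries, div_eq_mul_one_div, ← indSeries_compl_zero]
  have (c : F) (x : LF F) : (toL F (C c) * x).coeff m = c * x.coeff m := by
    rw [toL, aeval_C, algebraMap_eq_single, HahnSeries.coeff_single_mul, sub_zero]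
  rw [HahnSeries.coeff_add, this, this]

theorem digitSeries_mem_MDS {A : Set F} {a b : F} (ha : a ∈ A) (hb : b ∈ A) {S : Set ℕ}
    (hS : 0 ∉ S) : digitSeries a (b - a) S ∈ MDS F A := by
  refine ⟨fun m hm => ?_, fun m hm => ?_⟩
  · rw [coeff_digitSeries]
    rcases hm.lt_or_eq with h | rfl
    · simp [coeff_indSeries_of_neg _ h]
    · have (S : Set ℕ) (h : 0 ∉ S) : (indSeries F S).coeff 0 = 0 := by
        simpa [h] using coeff_indSeries_natCast (F := F) S 0
      simp [this _ hS, this {0}ᶜ (by simp)]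
  · obtain ⟨n, rfl⟩ : ∃ n : ℕ, m = n := ⟨m.toNat, by omega⟩
    rw [coeff_digitSeries, coeff_indSeries_natCast, coeff_indSeries_natCast,
      if_pos (by simp; omega)]
    split_ifs <;> simpa

theorem digitSeries_injective (a : F) {c : F} (hc : c ≠ 0) :
    Function.Injective (digitSeries a c) := by
  intro S T h
  ext n
  have := congrArg (fun x => HahnSeries.coeff x (n : ℤ)) h
  simp only [coeff_digitSeries, coeff_indSeries_natCast] at this
  by_cases hS : n ∈ S <;> by_cases hT : n ∈ T <;> simp_all

theorem toL_foldNum_div {d : ℕ → ℕ} (hd : StrictMono d) (k : ℕ) :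
    toL F (foldNum F d k) / XL F ^ d k =
      ∑ j ∈ Finset.range (k + 1), HahnSeries.single (d j : ℤ) 1 := by
  have hX : XL F ≠ 0 := by simp [XL]
  have hinv (n : ℕ) : 1 / XL F ^ n = HahnSeries.single (n : ℤ) 1 := by
    rw [div_eq_iff (pow_ne_zero _ hX), XL_pow, HahnSeries.single_mul_single]
    simp
  induction k with
  | zero => simp [foldNum, toL, ← hinv]
  | succ k ih =>
    rw [Finset.sum_range_succ, ← ih, ← hinv]
    have hpow : XL F ^ d (k + 1) = XL F ^ d k * XL F ^ (d (k + 1) - d k) := by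
      rw [← pow_add, Nat.add_sub_cancel' (hd k.lt_add_one).le]
    have hrec : toL F (foldNum F d (k + 1)) =
        1 + toL F (foldNum F d k) * XL F ^ (d (k + 1) - d k) := by
      simp [foldNum, toL]
    rw [hrec, hpow]
    field_simp
    ring

theorem digitSeries_sub_div (a : F) {c : F} (hc : c ≠ 0) (S : Set ℕ) (g : F[X]) {h : F[X]}
    (hh : h ≠ 0) :
    digitSeries a c S - toL F g / toL F h = toL F (C c) *
      (indSeries F S - toL F (C c⁻¹ * ((X - 1) * g - C a * h)) / toL F ((X - 1) * h)) := by
  have h1 := toL_ne_zero hh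
  have h2 : toL F (X - 1) ≠ 0 := toL_ne_zero (X_sub_C_ne_zero 1)
  have hcc : toL F (C c) * toL F (C c⁻¹) = 1 := by
    simp [toL, hc]
  have h3 : toL F (C c⁻¹ * ((X - 1) * g - C a * h)) =
      toL F (C c⁻¹) * (toL F (X - 1) * toL F g - toL F (C a) * toL F h) := by
    simp [toL]
  have h4 : toL F ((X - 1) * h) = toL F (X - 1) * toL F h := by simp [toL]
  rw [digitSeries, h3, h4, mul_sub, mul_div_assoc', ← mul_assoc, hcc]
  field_simp
  ring

end Embedding

section AbsoluteValue

open Polynomial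

variable {F}

theorem one_lt_qc : (1 : ℝ) < qc F := by
  exact_mod_cast Fintype.one_lt_card

theorem qc_pos : (0 : ℝ) < qc F := zero_lt_one.trans one_lt_qc

theorem absv_mul (x y : LF F) : absv F (x * y) = absv F x * absv F y := by
  by_cases hx : x = 0
  · simp [absv, hx]
  by_cases hy : y = 0
  · simp [absv, hy]
  rw [absv, absv, absv, if_neg (mul_ne_zero hx hy), if_neg hx, if_neg hy,
    HahnSeries.order_mul hx hy, neg_add, zpow_add₀ qc_pos.ne']

variable (F) in
/-- The absolute value as a monoid homomorphism. -/
def absvHom : LF F →*₀ ℝ where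
  toFun := absv F
  map_zero' := by simp [absv]
  map_one' := by simp [absv]
  map_mul' := absv_mul

theorem absv_div (x y : LF F) : absv F (x / y) = absv F x / absv F y :=
  map_div₀ (absvHom F) x y

theorem absv_neg (x : LF F) : absv F (-x) = absv F x := by
  simp [absv, HahnSeries.order_neg]

theorem absv_nonneg (x : LF F) : 0 ≤ absv F x := by
  unfold absv
  split_ifs
  · rfl
  · exact (zpow_pos qc_pos _).le

theorem absv_le_of_coeff_eq_zero {x : LF F} {n : ℤ} (h : ∀ m < n, x.coeff m = 0) :
    absv F x ≤ (qc F : ℝ) ^ (-n) := by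
  unfold absv
  split_ifs with h0
  · exact (zpow_pos qc_pos _).le
  · refine zpow_le_zpow_right₀ one_lt_qc.le (neg_le_neg ?_)
    by_contra! hlt
    exact h0 (HahnSeries.coeff_order_eq_zero.1 (h _ hlt))

theorem absv_sub_le (x y : LF F) : absv F (x - y) ≤ max (absv F x) (absv F y) := by
  by_cases hx : x = 0
  · simp [hx, absv_neg]
  by_cases hy : y = 0
  · simp [hy]
  by_cases hxy : x - y = 0
  · rw [hxy, absv, if_pos rfl]
    exact le_max_of_le_left (absv_nonneg x)
  have hmin := HahnSeries.min_order_le_order_add (x := x) (y := -y) (by rwa [← sub_eq_add_neg])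
  rw [← sub_eq_add_neg, HahnSeries.order_neg] at hmin
  rw [absv, absv, absv, if_neg hx, if_neg hy, if_neg hxy]
  rcases min_le_iff.1 hmin with h | h
  · exact le_max_of_le_left (zpow_le_zpow_right₀ one_lt_qc.le (neg_le_neg h))
  · exact le_max_of_le_right (zpow_le_zpow_right₀ one_lt_qc.le (neg_le_neg h))

theorem absv_toL {g : F[X]} (hg : g ≠ 0) : absv F (toL F g) = (qc F : ℝ) ^ (g.natDegree : ℝ) := by
  have h0 := toL_ne_zero hg
  have hord : (toL F g).order = -g.natDegree := by
    refine le_antisymm (HahnSeries.order_le_of_coeff_ne_zero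
      (coeff_toL_natDegree_ne_zero hg)) ?_
    rw [HahnSeries.le_order_iff_forall h0]
    exact fun m hm => coeff_toL_eq_zero g hm
  rw [absv, if_neg h0, hord, neg_neg, zpow_natCast, Real.rpow_natCast]

theorem absv_toL_C {c : F} (hc : c ≠ 0) : absv F (toL F (C c)) = 1 := by
  rw [absv_toL (C_ne_zero.2 hc)]
  simp

end AbsoluteValue

section Lacunary

open Polynomial

variable {F}

theorem absv_indSeries_sub_le {d : ℕ → ℕ} (hd : StrictMono d) (k : ℕ) :
    absv F (indSeries F (Set.range d) - toL F (foldNum F d k) / toL F (X ^ d k)) ≤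
      (qc F : ℝ) ^ (-(d (k + 1) : ℝ)) := by
  rw [Real.rpow_neg qc_pos.le, Real.rpow_natCast, ← zpow_natCast, ← zpow_neg]
  refine absv_le_of_coeff_eq_zero fun m hm => ?_
  rw [toL_X_pow, toL_foldNum_div hd, HahnSeries.coeff_sub, HahnSeries.coeff_sum]
  simp only [HahnSeries.coeff_single]
  rcases lt_or_ge m 0 with h | h
  · rw [coeff_indSeries_of_neg _ h, Finset.sum_eq_zero, sub_zero]
    intro j _
    exact if_neg (by omega)
  · lift m to ℕ using h
    rw [coeff_indSeries_natCast]
    split_ifs with hmem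
    · obtain ⟨j, rfl⟩ := hmem
      have hj : j < k + 1 := hd.lt_iff_lt.1 (by exact_mod_cast hm)
      rw [Finset.sum_eq_single j, if_pos rfl, sub_self]
      · intro i _ hi
        exact if_neg fun h => hi (hd.injective (by exact_mod_cast h.symm))
      · intro h
        exact absurd (Finset.mem_range.2 hj) h
    · rw [Finset.sum_eq_zero, sub_zero]
      intro j _
      exact if_neg fun h => hmem ⟨j, by exact_mod_cast h.symm⟩

/-- A fold bound for all the truncations bounds the distance of the lacunary series to every
fraction from below. -/
theorem le_absv_indSeries_sub {d : ℕ → ℕ} {α C : ℝ} (hα : 0 ≤ α) (hd : StrictMono d)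
    (hH : ∀ k, FoldBound (foldNum F d k) (d k) α C) {g h : F[X]} (hh : h ≠ 0) :
    (qc F : ℝ) ^ (-((2 + α) * h.natDegree + C)) ≤
      absv F (indSeries F (Set.range d) - toL F g / toL F h) := by
  obtain ⟨k, hk⟩ := exists_nat_gt (max (h.natDegree : ℝ) ((2 + α) * h.natDegree + C))
  have hkd : (k : ℝ) ≤ d k := by exact_mod_cast hd.id_le k
  have hkd' : (d k : ℝ) ≤ d (k + 1) := by exact_mod_cast (hd k.lt_add_one).le
  have hhd : h.natDegree < d k := by
    exact_mod_cast (le_max_left _ _).trans_lt (hk.trans_le hkd)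
  have hdvd : (X : F[X]) ^ d k ∣ h * foldNum F d k - (h * foldNum F d k - X ^ d k * g) :=
    ⟨g, by ring⟩
  have key := hH k h _ hh hhd hdvd
  have hr0 := ne_zero_of_X_pow_dvd_mul_sub (by simp [foldNum_coeff_zero hd]) hh hhd hdvd
  set r := h * foldNum F d k - X ^ d k * g with hr
  have hXk : (X : F[X]) ^ d k ≠ 0 := pow_ne_zero _ X_ne_zero
  have hfrac : toL F (foldNum F d k) / toL F (X ^ d k) - toL F g / toL F h =
      toL F r / (toL F h * toL F (X ^ d k)) := by
    have hLr : toL F r = toL F h * toL F (foldNum F d k) - toL F (X ^ d k) * toL F g := by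
      simp [hr, toL]
    rw [hLr]
    have h1 := toL_ne_zero hh
    have h2 := toL_ne_zero hXk
    field_simp
  have habs : (qc F : ℝ) ^ (-((2 + α) * h.natDegree + C)) ≤
      absv F (toL F (foldNum F d k) / toL F (X ^ d k) - toL F g / toL F h) := by
    rw [hfrac, absv_div, absv_mul, absv_toL hr0, absv_toL hh, absv_toL hXk, natDegree_X_pow,
      ← Real.rpow_add qc_pos, ← Real.rpow_sub qc_pos]
    refine Real.rpow_le_rpow_of_exponent_le one_lt_qc.le ?_
    have := mul_le_mul_of_nonneg_left (min_le_left (h.natDegree : ℝ) r.natDegree) hα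
    linarith
  have htail : absv F (indSeries F (Set.range d) - toL F (foldNum F d k) / toL F (X ^ d k)) <
      (qc F : ℝ) ^ (-((2 + α) * h.natDegree + C)) := by
    refine (absv_indSeries_sub_le hd k).trans_lt ?_
    refine Real.rpow_lt_rpow_of_exponent_lt one_lt_qc (neg_lt_neg ?_)
    exact (le_max_right _ _).trans_lt (hk.trans_le (hkd.trans hkd'))
  have hmax := absv_sub_le (indSeries F (Set.range d) - toL F g / toL F h)
    (indSeries F (Set.range d) - toL F (foldNum F d k) / toL F (X ^ d k))
  rw [sub_sub_sub_cancel_left] at hmax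
  rcases le_max_iff.1 hmax with h | h
  · exact habs.trans h
  · exact absurd (habs.trans h) htail.not_ge

end Lacunary

section IrrationalityExponent

open Polynomial Filter

variable {F}

theorem absv_digitSeries_le_one (a c : F) (S : Set ℕ) : absv F (digitSeries a c S) ≤ 1 := by
  have := absv_le_of_coeff_eq_zero (x := digitSeries a c S) (n := 0) fun m hm => by
    simp [coeff_digitSeries, coeff_indSeries_of_neg _ hm]
  simpa using this

theorem finite_setOf_natDegree_le (N : ℕ) : {g : F[X] | g.natDegree ≤ N}.Finite := by
  have : Finite (degreeLT F (N + 1)) := Finite.of_equiv _ (degreeLTEquiv F (N + 1)).symm.toEquiv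
  refine (Set.toFinite (degreeLT F (N + 1) : Set F[X])).subset fun g hg => ?_
  rw [SetLike.mem_coe, mem_degreeLT]
  exact degree_le_natDegree.trans_lt (by exact_mod_cast Nat.lt_succ_of_le hg)

theorem natDegree_le_of_absv_sub_le_one {ξ : LF F} (hξ : absv F ξ ≤ 1) {g h : F[X]} (hh : h ≠ 0)
    (hgh : absv F (ξ - toL F g / toL F h) ≤ 1) : g.natDegree ≤ h.natDegree := by
  by_cases hg : g = 0
  · simp [hg]
  have hmax := (absv_sub_le ξ (ξ - toL F g / toL F h)).trans (max_le hξ hgh)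
  rw [sub_sub_cancel, absv_div, absv_toL hg, absv_toL hh, ← Real.rpow_sub qc_pos,
    ← Real.rpow_zero (qc F : ℝ), Real.rpow_le_rpow_left_iff one_lt_qc, sub_nonpos] at hmax
  exact_mod_cast hmax

theorem irrExp_digitSeries_le (a : F) {c : F} (hc : c ≠ 0) {d : ℕ → ℕ} {α K : ℝ} (hα : 0 ≤ α)
    (hd : StrictMono d) (hH : ∀ k, FoldBound (foldNum F d k) (d k) α K) :
    irrExp F (digitSeries a c (Set.range d)) ≤ ENNReal.ofReal (2 + α) := by
  refine sSup_le ?_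
  rintro _ ⟨σ, rfl, hinf⟩
  refine ENNReal.ofReal_le_ofReal ?_
  by_contra! hσ
  refine hinf ?_
  obtain ⟨N, hN⟩ := exists_nat_ge ((2 + α + K) / (σ - (2 + α)))
  rw [div_le_iff₀ (sub_pos.2 hσ)] at hN
  refine ((finite_setOf_natDegree_le N).prod (finite_setOf_natDegree_le N)).subset ?_
  rintro ⟨g, h⟩ ⟨hh, hlt⟩
  simp only at hh hlt
  rw [absv_toL hh, ← Real.rpow_mul qc_pos.le] at hlt
  have hX : (X - 1 : F[X]) ≠ 0 := X_sub_C_ne_zero 1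
  have hdeg : ((X - 1) * h).natDegree = h.natDegree + 1 := by
    rw [natDegree_mul hX hh, ← C_1, natDegree_X_sub_C, add_comm]
  have hhN : h.natDegree ≤ N := by
    have hle := le_absv_indSeries_sub hα hd hH (g := C c⁻¹ * ((X - 1) * g - C a * h))
      (mul_ne_zero hX hh)
    have heq := congrArg (absv F) (digitSeries_sub_div a hc (Set.range d) g hh)
    rw [absv_mul, absv_toL_C hc, one_mul] at heq
    rw [← heq, hdeg] at hle
    have hexp := (Real.rpow_lt_rpow_left_iff one_lt_qc).1 (hle.trans_lt hlt)
    push_cast at hexp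
    have : (h.natDegree : ℝ) * (σ - (2 + α)) < N * (σ - (2 + α)) := by linarith
    exact_mod_cast (lt_of_mul_lt_mul_right this (sub_pos.2 hσ).le).le
  have hone : absv F (digitSeries a c (Set.range d) - toL F g / toL F h) ≤ 1 := by
    refine hlt.le.trans (Real.rpow_le_one_of_one_le_of_nonpos one_lt_qc.le ?_)
    have : 0 ≤ (h.natDegree : ℝ) * σ := by
      have : 0 ≤ σ := by linarith
      positivity
    linarith
  exact ⟨(natDegree_le_of_absv_sub_le_one (absv_digitSeries_le_one _ _ _) hh hone).trans hhN, hhN⟩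

theorem absv_digitSeries_sub_le (a : F) {c : F} (hc : c ≠ 0) {d : ℕ → ℕ} (hd : StrictMono d)
    (k : ℕ) :
    absv F (digitSeries a c (Set.range d) - toL F (C a * X ^ d k + C c * foldNum F d k * (X - 1)) /
      toL F ((X - 1) * X ^ d k)) ≤ (qc F : ℝ) ^ (-(d (k + 1) : ℝ)) := by
  refine le_of_eq_of_le ?_ (absv_indSeries_sub_le hd k)
  rw [← one_mul (absv F (indSeries F _ - _)), ← absv_toL_C hc, ← absv_mul]
  congr 1
  have h1 : toL F (X - 1) ≠ 0 := toL_ne_zero (X_sub_C_ne_zero 1)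
  have h2 : toL F (X ^ d k) ≠ 0 := toL_ne_zero (pow_ne_zero _ X_ne_zero)
  have h3 : toL F (C a * X ^ d k + C c * foldNum F d k * (X - 1)) =
      toL F (C a) * toL F (X ^ d k) + toL F (C c) * toL F (foldNum F d k) * toL F (X - 1) := by
    simp [toL]
  have h4 : toL F ((X - 1) * X ^ d k) = toL F (X - 1) * toL F (X ^ d k) := by simp [toL]
  rw [digitSeries, h3, h4]
  field_simp
  ring

theorem le_irrExp_digitSeries (a : F) {c : F} (hc : c ≠ 0) {d : ℕ → ℕ} (hd : StrictMono d)
    {τ : ℝ≥0∞} (hτ : ∀ σ : ℝ, 0 ≤ σ → ENNReal.ofReal σ < τ →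
      ∀ᶠ k in atTop, σ * (d k + 1) < d (k + 1)) :
    τ ≤ irrExp F (digitSeries a c (Set.range d)) := by
  refine le_of_forall_lt_imp_le_of_dense fun t ht => ?_
  have htt : ENNReal.ofReal t.toReal = t := ENNReal.ofReal_toReal ht.ne_top
  obtain ⟨K, hK⟩ := eventually_atTop.1 (hτ t.toReal ENNReal.toReal_nonneg (htt.trans_lt ht))
  refine le_sSup ⟨t.toReal, htt.symm, ?_⟩
  have hX : (X - 1 : F[X]) ≠ 0 := X_sub_C_ne_zero 1
  have hXd (n : ℕ) : (X - 1) * (X : F[X]) ^ n ≠ 0 := mul_ne_zero hX (pow_ne_zero _ X_ne_zero)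
  have hdeg (n : ℕ) : ((X - 1) * (X : F[X]) ^ n).natDegree = n + 1 := by
    rw [natDegree_mul_X_pow _ hX, ← C_1, natDegree_X_sub_C, add_comm]
  refine Set.infinite_of_injective_forall_mem (α := ℕ) (f := fun k =>
    (C a * X ^ d (k + K) + C c * foldNum F d (k + K) * (X - 1), (X - 1) * X ^ d (k + K))) ?_ ?_
  · intro i j hij
    have := congrArg natDegree (Prod.ext_iff.1 hij).2
    simp only [hdeg] at this
    have := hd.injective (Nat.succ_injective this)
    omega
  · intro k
    refine ⟨hXd _, (absv_digitSeries_sub_le a hc hd _).trans_lt ?_⟩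
    rw [absv_toL (hXd _), hdeg, ← Real.rpow_mul qc_pos.le]
    refine Real.rpow_lt_rpow_of_exponent_lt one_lt_qc ?_
    have := hK (k + K) (Nat.le_add_left _ _)
    push_cast
    linarith

end IrrationalityExponent

section Positions

/-- The positions of the exceptional digits: `f` prescribes the growth, and `s` the places where
one is added. -/
def posSeq (f : ℕ → ℕ → ℕ) (s : Set ℕ) : ℕ → ℕ
  | 0 => 1
  | k + 1 => f k (posSeq f s k) + if k ∈ s then 1 else 0

variable {f : ℕ → ℕ → ℕ}

theorem two_mul_posSeq_le (hf : ∀ k x, 2 * x ≤ f k x) (s : Set ℕ) (k : ℕ) :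
    2 * posSeq f s k ≤ posSeq f s (k + 1) :=
  (hf k _).trans (Nat.le_add_right _ _)

theorem posSeq_pos (hf : ∀ k x, 2 * x ≤ f k x) (s : Set ℕ) (k : ℕ) : 0 < posSeq f s k := by
  induction k with
  | zero => exact one_pos
  | succ k ih =>
    have := two_mul_posSeq_le hf s k
    omega

theorem posSeq_strictMono (hf : ∀ k x, 2 * x ≤ f k x) (s : Set ℕ) : StrictMono (posSeq f s) :=
  strictMono_nat_of_lt_succ fun k => by
    have := two_mul_posSeq_le hf s k
    have := posSeq_pos hf s k
    omega

theorem posSeq_injective (f : ℕ → ℕ → ℕ) : Function.Injective (posSeq f) := by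
  intro s t h
  ext k
  have h0 := congrFun h k
  have h1 := congrFun h (k + 1)
  rw [posSeq, posSeq, h0, Nat.add_left_cancel_iff] at h1
  by_cases hs : k ∈ s <;> by_cases ht : k ∈ t <;> simp_all

theorem not_countable_irrExp_of_posSeq {F : Type} [Field F] [Fintype F] {A : Set F} {a b : F}
    (ha : a ∈ A) (hb : b ∈ A) (hab : b - a ≠ 0) {τ : ℝ≥0∞} (hf : ∀ k x, 2 * x ≤ f k x)
    (hτ : ∀ s, irrExp F (digitSeries a (b - a) (Set.range (posSeq f s))) = τ) :
    ¬ {ξ ∈ MDS F A | irrExp F ξ = τ}.Countable := by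
  intro hcount
  have hinj : Function.Injective fun s => digitSeries a (b - a) (Set.range (posSeq f s)) := by
    intro s t hst
    exact posSeq_injective f (((posSeq_strictMono hf s).range_inj (posSeq_strictMono hf t)).1
      (digitSeries_injective a hab hst))
  have hmem (s : Set ℕ) : digitSeries a (b - a) (Set.range (posSeq f s)) ∈
      {ξ ∈ MDS F A | irrExp F ξ = τ} := by
    refine ⟨digitSeries_mem_MDS ha hb ?_, hτ s⟩
    rintro ⟨k, hk⟩
    exact (posSeq_pos hf s k).ne' hk
  have := hcount.to_subtype
  have : Countable (Set ℕ) :=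
    (hinj.codRestrict hmem).countable
  obtain ⟨e, he⟩ := exists_injective_nat (Set ℕ)
  exact Function.cantor_injective e he

theorem irrExp_posSeq_top {F : Type} [Field F] [Fintype F] (a : F) {c : F} (hc : c ≠ 0)
    (s : Set ℕ) :
    irrExp F (digitSeries a c (Set.range (posSeq (fun k x => (k + 2) * x) s))) = ⊤ := by
  have hf (k x : ℕ) : 2 * x ≤ (k + 2) * x := Nat.mul_le_mul_right _ (by omega)
  refine top_le_iff.1 (le_irrExp_digitSeries a hc (posSeq_strictMono hf s) fun σ hσ _ => ?_)
  filter_upwards [Filter.eventually_ge_atTop ⌈2 * σ⌉₊] with k hk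
  have h1 : (1 : ℝ) ≤ posSeq (fun k x => (k + 2) * x) s k := by
    exact_mod_cast posSeq_pos hf s k
  have h2 : ((k + 2) * posSeq (fun k x => (k + 2) * x) s k : ℝ) ≤
      posSeq (fun k x => (k + 2) * x) s (k + 1) := by
    exact_mod_cast Nat.le_add_right _ _
  refine lt_of_lt_of_le ?_ h2
  have := Nat.ceil_le.1 hk
  nlinarith

theorem two_mul_le_ceil {t : ℝ} (ht : 2 ≤ t) (x : ℕ) : 2 * x ≤ ⌈t * x⌉₊ := by
  have : ((2 * x : ℕ) : ℝ) ≤ ⌈t * x⌉₊ := by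
    refine le_trans ?_ (Nat.le_ceil _)
    push_cast
    gcongr
  exact_mod_cast this

theorem irrExp_posSeq_ceil {F : Type} [Field F] [Fintype F] (a : F) {c : F} (hc : c ≠ 0)
    {t : ℝ} (ht : 2 ≤ t) (s : Set ℕ) :
    irrExp F (digitSeries a c (Set.range (posSeq (fun _ x => ⌈t * x⌉₊) s))) =
      ENNReal.ofReal t := by
  have hf (_ x : ℕ) : 2 * x ≤ ⌈t * x⌉₊ := two_mul_le_ceil ht x
  have hd := posSeq_strictMono hf s
  have hlow (k : ℕ) : t * posSeq (fun _ x => ⌈t * x⌉₊) s k ≤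
      posSeq (fun _ x => ⌈t * x⌉₊) s (k + 1) := by
    refine (Nat.le_ceil _).trans ?_
    exact_mod_cast Nat.le_add_right _ _
  have hupp (k : ℕ) : (posSeq (fun _ x => ⌈t * x⌉₊) s (k + 1) : ℝ) ≤
      (2 + (t - 2)) * posSeq (fun _ x => ⌈t * x⌉₊) s k + 2 := by
    have h1 := Nat.ceil_lt_add_one (a := t * posSeq (fun _ x => ⌈t * x⌉₊) s k) (by positivity)
    have h2 : (posSeq (fun _ x => ⌈t * x⌉₊) s (k + 1) : ℝ) ≤
        ⌈t * posSeq (fun _ x => ⌈t * x⌉₊) s k⌉₊ + 1 := by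
      have : posSeq (fun _ x => ⌈t * x⌉₊) s (k + 1) ≤
          ⌈t * posSeq (fun _ x => ⌈t * x⌉₊) s k⌉₊ + 1 := by
        rw [posSeq]
        gcongr
        split_ifs <;> simp
      exact_mod_cast this
    linarith
  apply le_antisymm
  · have := irrExp_digitSeries_le a hc (sub_nonneg.2 ht) hd
      (foldBound_foldNum (sub_nonneg.2 ht) hd (posSeq_pos hf s 0) (C := 2) (by simp [posSeq])
        (two_mul_posSeq_le hf s) hupp)
    rwa [add_sub_cancel] at this
  · refine le_irrExp_digitSeries a hc hd fun σ hσ hlt => ?_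
    have hσt : 0 < t - σ := sub_pos.2 (ENNReal.ofReal_lt_ofReal_iff'.1 hlt).1
    filter_upwards [Filter.eventually_gt_atTop ⌈σ / (t - σ)⌉₊] with k hk
    refine lt_of_lt_of_le ?_ (hlow k)
    have h1 : (k : ℝ) ≤ posSeq (fun _ x => ⌈t * x⌉₊) s k := by exact_mod_cast hd.id_le k
    have h2 := (div_lt_iff₀ hσt).1 ((Nat.lt_of_ceil_lt hk).trans_le h1)
    linarith

end Positions

/-- Let `𝒜 ⊆ 𝔽_q` with `2 ≤ #𝒜 < q`.  For any `τ ∈ [2, ∞]` there exist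
uncountably many elements of the missing digit set `MDS(𝒜)` with irrationality exponent `τ`. -/
theorem mds_uncountably_many_with_irrExp (A : Set F) (hA1 : 2 ≤ A.ncard)
    (hA2 : A.ncard < qc F) (τ : ℝ≥0∞) (hτ : 2 ≤ τ) :
    ¬ {ξ ∈ MDS F A | irrExp F ξ = τ}.Countable := by
  obtain ⟨a, ha, b, hb, hab⟩ := (Set.one_lt_ncard (Set.toFinite A)).1 hA1
  have hba : b - a ≠ 0 := sub_ne_zero.2 hab.symm
  rcases eq_or_ne τ ⊤ with rfl | htop
  · exact not_countable_irrExp_of_posSeq ha hb hba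
      (fun k x => Nat.mul_le_mul_right x (Nat.le_add_left 2 k)) (irrExp_posSeq_top a hba)
  · have ht : 2 ≤ τ.toReal := by simpa using ENNReal.toReal_mono htop hτ
    exact not_countable_irrExp_of_posSeq ha hb hba (fun _ x => two_mul_le_ceil ht x) fun s =>
      (irrExp_posSeq_ceil a hba ht s).trans (ENNReal.ofReal_toReal htop)
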